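/- (Existence of paths with maximal margin.) Let G be a priority graph. (1) If Φ(χ^free_G) ≠ ∅ and the set S = {r ≥ 0 : Φ(χ^free_G ⊖ [−r,r]^n) ≠ ∅} is bounded above, then its supremum ρ_G belongs to S, i.e., Φ(χ^free_G ⊖ [−ρ_G,ρ_G]^n) ≠ ∅. (2) If Φ(χ^free_G) = ∅, then the set T = {r > 0 : Φ(χ^free_G + [−r,r]^n) ≠ ∅} is nonempty and its infimum ρ belongs to T, i.e., Φ(χ^free_G + [−ρ,ρ]^n) ≠ ∅. -/

import Mathlib

open Set

noncomputable section

/-- Canonical basis vector `e i` of the coordination space `ℝ^n`. -/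
def basisVec (n : ℕ) (i : Fin n) : Fin n → ℝ := Pi.single i 1

/-- Collision cylinder `χ^obs_{ij} = {x : (x i, x j) ∈ κ i j}`. -/
def cyl (n : ℕ) (κ : Fin n → Fin n → Set (ℝ × ℝ)) (i j : Fin n) : Set (Fin n → ℝ) :=
  {x | (x i, x j) ∈ κ i j}

/-- Completed cylinder `χ^obs_{i≻j} = χ^obs_{ij} − ℝ₊ e_i + ℝ₊ e_j` (Minkowski sums). -/
def cylPr (n : ℕ) (κ : Fin n → Fin n → Set (ℝ × ℝ)) (i j : Fin n) : Set (Fin n → ℝ) :=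
  {z | ∃ y ∈ cyl n κ i j, ∃ a b : ℝ, 0 ≤ a ∧ 0 ≤ b ∧
    z = y - a • basisVec n i + b • basisVec n j}

/-- Obstacle region `χ^obs = ⋃_{i,j} χ^obs_{ij}`. -/
def obsRegion (n : ℕ) (κ : Fin n → Fin n → Set (ℝ × ℝ)) : Set (Fin n → ℝ) :=
  ⋃ i, ⋃ j, cyl n κ i j

/-- Obstacle-free region `χ^free = χ \ χ^obs`. -/
def freeRegion (n : ℕ) (κ : Fin n → Fin n → Set (ℝ × ℝ)) : Set (Fin n → ℝ) :=
  (obsRegion n κ)ᶜ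

/-- Standing hypotheses on the collision data `κ`: each `κ i j` is open, bounded and
convex, `κ i i = ∅`, and `(a,b) ∈ κ i j ↔ (b,a) ∈ κ j i`. -/
def KappaHyp (n : ℕ) (κ : Fin n → Fin n → Set (ℝ × ℝ)) : Prop :=
  (∀ i j, IsOpen (κ i j)) ∧ (∀ i j, Bornology.IsBounded (κ i j)) ∧
  (∀ i j, Convex ℝ (κ i j)) ∧ (∀ i, κ i i = ∅) ∧
  (∀ (i j : Fin n) (a b : ℝ), (a, b) ∈ κ i j ↔ (b, a) ∈ κ j i)

/-- `PhiMem n C φ` : `φ` restricted to `[0,1]` is a continuous nondecreasing path whose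
image lies in `C`, with `φ 0 − ℝ₊^n ⊆ C` and `φ 1 + ℝ₊^n ⊆ C` (the set `Φ(C)`). -/
def PhiMem (n : ℕ) (C : Set (Fin n → ℝ)) (φ : ℝ → Fin n → ℝ) : Prop :=
  ContinuousOn φ (Icc 0 1) ∧
  (∀ t1 ∈ Icc (0:ℝ) 1, ∀ t2 ∈ Icc (0:ℝ) 1, t1 ≤ t2 → φ t1 ≤ φ t2) ∧
  (∀ t ∈ Icc (0:ℝ) 1, φ t ∈ C) ∧
  (∀ d : Fin n → ℝ, 0 ≤ d → φ 0 - d ∈ C) ∧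
  (∀ d : Fin n → ℝ, 0 ≤ d → φ 1 + d ∈ C)

/-- A priority graph: `E i j ↔ (χ^obs_{ij} ≠ ∅ ∧ ¬ E j i)`. -/
def IsPriorityGraph (n : ℕ) (κ : Fin n → Fin n → Set (ℝ × ℝ))
    (E : Fin n → Fin n → Prop) : Prop :=
  ∀ i j, E i j ↔ (cyl n κ i j ≠ ∅ ∧ ¬ E j i)

/-- Completed obstacle region `χ^obs_G = ⋃_{(i,j) ∈ E(G)} χ^obs_{i≻j}`. -/
def obsG (n : ℕ) (κ : Fin n → Fin n → Set (ℝ × ℝ))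
    (E : Fin n → Fin n → Prop) : Set (Fin n → ℝ) :=
  ⋃ i, ⋃ j, ⋃ (_ : E i j), cylPr n κ i j

/-- `χ^free_G = χ \ χ^obs_G`. -/
def freeG (n : ℕ) (κ : Fin n → Fin n → Set (ℝ × ℝ))
    (E : Fin n → Fin n → Prop) : Set (Fin n → ℝ) :=
  (obsG n κ E)ᶜ

/-- `E` contains a directed cycle. -/
def HasCycle (n : ℕ) (E : Fin n → Fin n → Prop) : Prop :=
  ∃ (m : ℕ) (v : ℕ → Fin n), 0 < m ∧ v m = v 0 ∧ ∀ k < m, E (v k) (v (k+1))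

/-- The obstacle region lies in a bounded region: there are `x̲^obs, x̄^obs ∈ χ^free`
bounding every collision cylinder in the relevant coordinates. -/
def ObsBounds (n : ℕ) (κ : Fin n → Fin n → Set (ℝ × ℝ))
    (xlo xhi : Fin n → ℝ) : Prop :=
  xlo ∈ freeRegion n κ ∧ xhi ∈ freeRegion n κ ∧
  ∀ i j : Fin n, ∀ x ∈ cyl n κ i j,
    (xlo i < x i ∧ x i < xhi i) ∧ (xlo j < x j ∧ x j < xhi j)

/-- Minkowski sum (dilation) `A + [−r,r]^n`. -/
def dil (n : ℕ) (A : Set (Fin n → ℝ)) (r : ℝ) : Set (Fin n → ℝ) :=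
  {z | ∃ y ∈ A, ∃ d : Fin n → ℝ, (∀ i, |d i| ≤ r) ∧ z = y + d}

/-- Erosion `A ⊖ [−r,r]^n = {x : x + [−r,r]^n ⊆ A}`. -/
def ero (n : ℕ) (A : Set (Fin n → ℝ)) (r : ℝ) : Set (Fin n → ℝ) :=
  {x | ∀ d : Fin n → ℝ, (∀ i, |d i| ≤ r) → x + d ∈ A}

/-- The set `S = {r ≥ 0 : Φ(χ^free_G ⊖ [−r,r]^n) ≠ ∅}`. -/
def marginSetS (n : ℕ) (κ : Fin n → Fin n → Set (ℝ × ℝ))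
    (E : Fin n → Fin n → Prop) : Set ℝ :=
  {r | 0 ≤ r ∧ ∃ φ : ℝ → Fin n → ℝ, PhiMem n (ero n (freeG n κ E) r) φ}

/-- The set `T = {r > 0 : Φ(χ^free_G + [−r,r]^n) ≠ ∅}`. -/
def marginSetT (n : ℕ) (κ : Fin n → Fin n → Set (ℝ × ℝ))
    (E : Fin n → Fin n → Prop) : Set ℝ :=
  {r | 0 < r ∧ ∃ φ : ℝ → Fin n → ℝ, PhiMem n (dil n (freeG n κ E) r) φ}

/-- Coordinatewise truncation to the box `[lo, hi]`. -/
def boxClamp {n : ℕ} (lo hi x : Fin n → ℝ) : Fin n → ℝ := lo ⊔ (x ⊓ hi)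

/-- Nondecreasing paths in `C ∩ [lo, hi]` parametrized affinely by the sum of the coordinates. -/
def sumPaths (n : ℕ) (lo hi : Fin n → ℝ) (C : Set (Fin n → ℝ)) : Set (ℝ → Fin n → ℝ) :=
  {γ | (∀ t, γ t ∈ Icc lo hi) ∧ Monotone γ ∧ (∀ t, γ t ∈ C) ∧
    ∀ t ∈ Icc (0 : ℝ) 1, ∑ i, γ t i = ∑ i, lo i + t * (∑ i, hi i - ∑ i, lo i)}

section Paths

variable {n : ℕ} {lo hi : Fin n → ℝ} {C D : Set (Fin n → ℝ)}

lemma eq_of_le_of_sum_le {x y : Fin n → ℝ} (h : x ≤ y) (hs : ∑ i, y i ≤ ∑ i, x i) : x = y := by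
  by_contra hne
  obtain ⟨i, hi⟩ : ∃ i, x i ≠ y i := by
    by_contra! hall
    exact hne (funext hall)
  exact absurd hs (not_le.2 (Finset.sum_lt_sum (fun j _ => h j)
    ⟨i, Finset.mem_univ i, lt_of_le_of_ne (h i) hi⟩))

lemma boxClamp_mem_Icc (h : lo ≤ hi) (x : Fin n → ℝ) : boxClamp lo hi x ∈ Icc lo hi :=
  ⟨le_sup_left, sup_le h inf_le_right⟩

lemma boxClamp_mono (lo hi : Fin n → ℝ) : Monotone (boxClamp lo hi) := fun _ _ h =>
  sup_le_sup_left (inf_le_inf_right _ h) _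

lemma boxClamp_of_le (h : lo ≤ hi) {x : Fin n → ℝ} (hx : x ≤ lo) : boxClamp lo hi x = lo := by
  rw [boxClamp, inf_eq_left.2 (hx.trans h), sup_eq_left.2 hx]

lemma boxClamp_of_ge (h : lo ≤ hi) {x : Fin n → ℝ} (hx : hi ≤ x) : boxClamp lo hi x = hi := by
  rw [boxClamp, inf_eq_right.2 hx, sup_eq_right.2 h]

lemma continuous_boxClamp (lo hi : Fin n → ℝ) : Continuous (boxClamp lo hi) :=
  continuous_pi fun i => continuous_const.max ((continuous_apply i).min continuous_const)

lemma sumPaths_mono (h : C ⊆ D) : sumPaths n lo hi C ⊆ sumPaths n lo hi D :=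
  fun _ ⟨h1, h2, h3, h4⟩ => ⟨h1, h2, fun t => h (h3 t), h4⟩

lemma isClosed_sumPaths (hC : IsClosed C) : IsClosed (sumPaths n lo hi C) := by
  have h1 : IsClosed {γ : ℝ → Fin n → ℝ | ∀ t, γ t ∈ Icc lo hi} := by
    simp only [ofPred_forall]
    exact isClosed_iInter fun t => isClosed_Icc.preimage (continuous_apply t)
  have h3 : IsClosed {γ : ℝ → Fin n → ℝ | ∀ t, γ t ∈ C} := by
    simp only [ofPred_forall]
    exact isClosed_iInter fun t => hC.preimage (continuous_apply t)
  have h4 : IsClosed {γ : ℝ → Fin n → ℝ | ∀ t ∈ Icc (0 : ℝ) 1,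
      ∑ i, γ t i = ∑ i, lo i + t * (∑ i, hi i - ∑ i, lo i)} := by
    simp only [ofPred_forall]
    exact isClosed_iInter fun t => isClosed_iInter fun _ =>
      isClosed_eq (by fun_prop) continuous_const
  exact h1.inter (isClosed_monotone.inter (h3.inter h4))

lemma isCompact_sumPaths (hC : IsClosed C) : IsCompact (sumPaths n lo hi C) :=
  (isCompact_univ_pi fun _ : ℝ => (isCompact_Icc : IsCompact (Icc lo hi))).of_isClosed_subset
    (isClosed_sumPaths hC) fun _ h t _ => h.1 t

lemma sumPaths_iInter_nonempty {ι : Type*} [Nonempty ι] (C : ι → Set (Fin n → ℝ))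
    (hdir : Directed (· ⊇ ·) C) (hcl : ∀ i, IsClosed (C i))
    (hne : ∀ i, (sumPaths n lo hi (C i)).Nonempty) :
    (sumPaths n lo hi (⋂ i, C i)).Nonempty := by
  obtain ⟨γ, hγ⟩ := IsCompact.nonempty_iInter_of_directed_nonempty_isCompact_isClosed
    (fun i => sumPaths n lo hi (C i))
    (fun i j => (hdir i j).imp fun k hk => ⟨sumPaths_mono hk.1, sumPaths_mono hk.2⟩) hne
    (fun i => isCompact_sumPaths (hcl i)) (fun i => isClosed_sumPaths (hcl i))
  rw [mem_iInter] at hγ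
  have h0 := hγ (Classical.arbitrary ι)
  exact ⟨γ, h0.1, h0.2.1, fun t => mem_iInter.2 fun i => (hγ i).2.2.1 t, h0.2.2.2⟩

lemma sumPaths_nonempty_of_phiMem (h : lo ≤ hi) (hC : ∀ x ∈ C, boxClamp lo hi x ∈ C)
    {φ : ℝ → Fin n → ℝ} (hφ : PhiMem n C φ) : (sumPaths n lo hi C).Nonempty := by
  obtain ⟨hcont, hmono, hmem, hstart, hend⟩ := hφ
  have hproj : ∀ t : ℝ, (projIcc (0 : ℝ) 1 zero_le_one t : ℝ) ∈ Icc (0 : ℝ) 1 :=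
    fun t => (projIcc (0 : ℝ) 1 zero_le_one t).2
  let f : ℝ → Fin n → ℝ := fun t => φ (projIcc (0 : ℝ) 1 zero_le_one t)
  have hf : Continuous f :=
    hcont.comp_continuous (continuous_subtype_val.comp continuous_projIcc) hproj
  have hfm : Monotone f := fun s t hst =>
    hmono _ (hproj s) _ (hproj t) (monotone_projIcc _ hst)
  let g : ℝ → Fin n → ℝ := fun t => f t + (fun _ => min t 0 + max (t - 1) 0)
  have hg : Continuous g := by fun_prop
  have hgm : Monotone g := fun s t hst => add_le_add (hfm hst) fun _ =>
    add_le_add (min_le_min_right _ hst) (max_le_max_right _ (by linarith))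
  have hleft : ∀ t ≤ 0, g t = φ 0 - fun _ => -t := by
    intro t ht
    ext i
    simp [g, f, projIcc_of_le_left zero_le_one ht, min_eq_left ht,
      max_eq_right (show t - 1 ≤ 0 by linarith)]
  have hright : ∀ t, 1 ≤ t → g t = φ 1 + fun _ => t - 1 := by
    intro t ht
    ext i
    simp [g, f, projIcc_of_right_le zero_le_one ht, min_eq_right (show 0 ≤ t by linarith),
      max_eq_left (show 0 ≤ t - 1 by linarith)]
  have hgC : ∀ t, g t ∈ C := by
    intro t
    rcases le_total t 0 with ht | ht
    · rw [hleft t ht]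
      exact hstart _ fun _ => by simpa using ht
    rcases le_total 1 t with ht1 | ht1
    · rw [hright t ht1]
      exact hend _ fun _ => by simpa using ht1
    · have : g t = f t := by ext i; simp [g, ht, ht1]
      rw [this]
      exact hmem _ (hproj t)
  let ψ : ℝ → Fin n → ℝ := fun t => boxClamp lo hi (g t)
  have hψ : Continuous ψ := (continuous_boxClamp lo hi).comp hg
  have hψm : Monotone ψ := (boxClamp_mono lo hi).comp hgm
  obtain ⟨A, hA⟩ : ∃ A, ψ A = lo := by
    refine ⟨-‖φ 0 - lo‖, boxClamp_of_le h ?_⟩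
    rw [hleft _ (by simp)]
    intro i
    have := (le_abs_self _).trans (norm_le_pi_norm (φ 0 - lo) i)
    simp only [Pi.sub_apply] at this ⊢
    linarith
  obtain ⟨B, hB⟩ : ∃ B, ψ B = hi := by
    refine ⟨1 + ‖hi - φ 1‖, boxClamp_of_ge h ?_⟩
    rw [hright _ (by simp)]
    intro i
    have := (le_abs_self _).trans (norm_le_pi_norm (hi - φ 1) i)
    simp only [Pi.sub_apply, Pi.add_apply] at this ⊢
    linarith
  have hL : 0 ≤ ∑ i, hi i - ∑ i, lo i := sub_nonneg.2 (Finset.sum_le_sum fun i _ => h i)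
  have hex : ∀ t : ℝ, ∃ s, ∑ i, ψ s i = ∑ i, lo i +
      (projIcc (0 : ℝ) 1 zero_le_one t : ℝ) * (∑ i, hi i - ∑ i, lo i) := by
    intro t
    refine mem_range_of_exists_le_of_exists_ge (f := fun s => ∑ i, ψ s i) (by fun_prop)
      ⟨A, ?_⟩ ⟨B, ?_⟩
    · simp only [hA]
      linarith [mul_nonneg (hproj t).1 hL]
    · simp only [hB]
      linarith [mul_le_mul_of_nonneg_right (hproj t).2 hL]
  choose σ hσ using hex
  refine ⟨fun t => ψ (σ t), fun t => boxClamp_mem_Icc h _, fun s t hst => ?_,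
    fun t => hC _ (hgC _), fun t ht => ?_⟩
  · rcases le_total (σ s) (σ t) with h1 | h1
    · exact hψm h1
    · refine (eq_of_le_of_sum_le (hψm h1) ?_).ge
      rw [hσ, hσ]
      have : (projIcc (0 : ℝ) 1 zero_le_one s : ℝ) ≤ projIcc (0 : ℝ) 1 zero_le_one t :=
        monotone_projIcc _ hst
      linarith [mul_le_mul_of_nonneg_right this hL]
  · rw [hσ t, projIcc_of_mem zero_le_one ht]

lemma phiMem_of_mem_sumPaths (hlo : ∀ d : Fin n → ℝ, 0 ≤ d → lo - d ∈ C)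
    (hhi : ∀ d : Fin n → ℝ, 0 ≤ d → hi + d ∈ C) {γ : ℝ → Fin n → ℝ}
    (hγ : γ ∈ sumPaths n lo hi C) : PhiMem n C γ := by
  obtain ⟨hbox, hmono, hmem, hsum⟩ := hγ
  have h0 : γ 0 = lo := by
    refine (eq_of_le_of_sum_le (hbox 0).1 ?_).symm
    rw [hsum 0 (by simp)]
    simp
  have h1 : γ 1 = hi := by
    refine eq_of_le_of_sum_le (hbox 1).2 ?_
    rw [hsum 1 (by simp)]
    simp
  refine ⟨?_, fun _ _ _ _ hst => hmono hst, fun t _ => hmem t, by rwa [h0], by rwa [h1]⟩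
  set L := ∑ i, hi i - ∑ i, lo i
  have key : ∀ s ∈ Icc (0 : ℝ) 1, ∀ t ∈ Icc (0 : ℝ) 1, s ≤ t → ∀ i,
      γ t i - γ s i ≤ L * (t - s) := by
    intro s hs t ht hst i
    have := Finset.single_le_sum (f := fun i => γ t i - γ s i)
      (fun j _ => sub_nonneg.2 (hmono hst j)) (Finset.mem_univ i)
    rw [Finset.sum_sub_distrib, hsum s hs, hsum t ht] at this
    linarith
  refine continuousOn_pi.2 fun i => ?_
  refine (LipschitzOnWith.of_le_add_mul' L fun s hs t ht => ?_).continuousOn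
  rcases le_total s t with hst | hst
  · have h2 := key s hs t ht hst i
    have h3 := hmono hst i
    rw [Real.dist_eq, abs_sub_comm, abs_of_nonneg (sub_nonneg.2 hst)]
    linarith
  · have h2 := key t ht s hs hst i
    rw [Real.dist_eq, abs_of_nonneg (sub_nonneg.2 hst)]
    linarith

end Paths

section Margins

variable {n : ℕ} {A : Set (Fin n → ℝ)}

lemma ero_antitone (A : Set (Fin n → ℝ)) : Antitone (ero n A) :=
  fun _ _ hrs _ hx d hd => hx d fun i => (hd i).trans hrs

lemma dil_monotone (A : Set (Fin n → ℝ)) : Monotone (dil n A) :=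
  fun _ _ hrs _ ⟨y, hy, d, hd, hz⟩ => ⟨y, hy, d, fun i => (hd i).trans hrs, hz⟩

lemma subset_dil {r : ℝ} (hr : 0 ≤ r) : A ⊆ dil n A r :=
  fun x hx => ⟨x, hx, 0, fun _ => by simpa using hr, by simp⟩

lemma subset_ero_zero : A ⊆ ero n A 0 := by
  intro x hx d hd
  have : d = 0 := funext fun i => abs_nonpos_iff.1 (hd i)
  simpa [this] using hx

lemma isClosed_ero (hA : IsClosed A) (r : ℝ) : IsClosed (ero n A r) := by
  simp only [ero, ofPred_forall]
  exact isClosed_iInter fun d => isClosed_iInter fun _ => hA.preimage (by fun_prop)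

lemma mem_ero_iff {r : ℝ} (hr : 0 ≤ r) {x : Fin n → ℝ} :
    x ∈ ero n A r ↔ Metric.closedBall x r ⊆ A := by
  constructor
  · intro h y hy
    have := h (y - x) fun i => by
      simpa [Real.dist_eq] using (dist_le_pi_dist y x i).trans (Metric.mem_closedBall.1 hy)
    simpa using this
  · intro h d hd
    refine h ?_
    rw [mem_closedBall_iff_norm, add_sub_cancel_left]
    exact (pi_norm_le_iff_of_nonneg hr).2 hd

lemma dil_eq_cthickening (hA : IsClosed A) {r : ℝ} (hr : 0 ≤ r) :
    dil n A r = Metric.cthickening r A := by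
  rw [hA.cthickening_eq_biUnion_closedBall hr]
  ext z
  simp only [mem_iUnion, exists_prop, mem_closedBall_iff_norm]
  constructor
  · rintro ⟨y, hy, d, hd, rfl⟩
    refine ⟨y, hy, ?_⟩
    rw [add_sub_cancel_left]
    exact (pi_norm_le_iff_of_nonneg hr).2 hd
  · rintro ⟨y, hy, hz⟩
    exact ⟨y, hy, z - y, (pi_norm_le_iff_of_nonneg hr).1 hz, by simp⟩

lemma iInter_ero_subset_ero_sSup (hA : IsClosed A) {S : Set ℝ} (hne : S.Nonempty)
    (h0 : ∀ r ∈ S, 0 ≤ r) (hpos : 0 < sSup S) :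
    ⋂ r : S, ero n A r ⊆ ero n A (sSup S) := by
  intro x hx
  rw [mem_ero_iff hpos.le, ← closure_ball x hpos.ne']
  refine closure_minimal (fun y hy => ?_) hA
  obtain ⟨r, hr, hlt⟩ := exists_lt_of_lt_csSup hne (Metric.mem_ball.1 hy)
  exact (mem_ero_iff (h0 r hr)).1 (mem_iInter.1 hx ⟨r, hr⟩) (Metric.mem_closedBall.2 hlt.le)

lemma iInter_dil_subset_dil_sInf (hA : IsClosed A) {T : Set ℝ} (hne : T.Nonempty)
    (h0 : ∀ r ∈ T, 0 ≤ r) :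
    ⋂ r : T, dil n A r ⊆ dil n A (sInf T) := by
  intro x hx
  have hρ : 0 ≤ sInf T := le_csInf hne h0
  rw [dil_eq_cthickening hA hρ, Metric.cthickening_eq_iInter_cthickening]
  refine mem_iInter₂.2 fun ε hε => ?_
  obtain ⟨r, hr, hlt⟩ := exists_lt_of_csInf_lt hne hε
  have := mem_iInter.1 hx ⟨r, hr⟩
  rw [dil_eq_cthickening hA (h0 r hr)] at this
  exact Metric.cthickening_mono hlt.le _ this

end Margins

section FreeSpace

variable {n : ℕ} {κ : Fin n → Fin n → Set (ℝ × ℝ)} {E : Fin n → Fin n → Prop}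
  {xlo xhi : Fin n → ℝ}

lemma mem_cylPr_iff {i j : Fin n} (hij : i ≠ j) {z : Fin n → ℝ} :
    z ∈ cylPr n κ i j ↔ ∃ y ∈ cyl n κ i j, z i ≤ y i ∧ y j ≤ z j := by
  constructor
  · rintro ⟨y, hy, a, b, ha, hb, rfl⟩
    exact ⟨y, hy, by simp [basisVec, hij, ha], by simp [basisVec, hij.symm, hb]⟩
  · rintro ⟨y, hy, h1, h2⟩
    refine ⟨z + (y i - z i) • basisVec n i - (z j - y j) • basisVec n j, ?_,
      y i - z i, z j - y j, sub_nonneg.2 h1, sub_nonneg.2 h2, by abel⟩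
    simpa [cyl, basisVec, hij, hij.symm] using hy

lemma isOpen_cylPr {i j : Fin n} (h : IsOpen (κ i j)) : IsOpen (cylPr n κ i j) := by
  have : cylPr n κ i j = ⋃ (a : ℝ) (b : ℝ) (_ : 0 ≤ a ∧ 0 ≤ b),
      (fun z => z + a • basisVec n i - b • basisVec n j) ⁻¹' cyl n κ i j := by
    ext z
    simp only [mem_iUnion, mem_preimage, exists_prop]
    constructor
    · rintro ⟨y, hy, a, b, ha, hb, rfl⟩
      refine ⟨a, b, ⟨ha, hb⟩, ?_⟩
      convert hy using 1
      abel
    · rintro ⟨a, b, ⟨ha, hb⟩, hz⟩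
      exact ⟨_, hz, a, b, ha, hb, by abel⟩
  rw [this]
  have hcyl : IsOpen (cyl n κ i j) :=
    h.preimage (f := fun x : Fin n → ℝ => (x i, x j)) (by fun_prop)
  exact isOpen_iUnion fun a => isOpen_iUnion fun b => isOpen_iUnion fun _ =>
    hcyl.preimage (by fun_prop)

lemma isClosed_freeG (hκ : KappaHyp n κ) : IsClosed (freeG n κ E) :=
  (isOpen_iUnion fun i => isOpen_iUnion fun j => isOpen_iUnion fun _ =>
    isOpen_cylPr (hκ.1 i j)).isClosed_compl

lemma mem_freeG_iff (hκ : KappaHyp n κ) (hE : IsPriorityGraph n κ E) {z : Fin n → ℝ} :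
    z ∈ freeG n κ E ↔ ∀ i j, E i j → ∀ y ∈ cyl n κ i j, z i ≤ y i → z j < y j := by
  have hne : ∀ i j, E i j → i ≠ j := by
    rintro i j hij rfl
    refine ((hE i i).1 hij).1 ?_
    simp [cyl, hκ.2.2.2.1 i]
  simp only [freeG, obsG, mem_compl_iff, mem_iUnion, not_exists]
  refine forall_congr' fun i => forall_congr' fun j => forall_congr' fun hij => ?_
  rw [mem_cylPr_iff (hne i j hij)]
  push Not
  rfl

lemma freeG_of_le (hκ : KappaHyp n κ) (hE : IsPriorityGraph n κ E)
    (hbd : ObsBounds n κ xlo xhi) {z : Fin n → ℝ} (hz : z ≤ xlo) : z ∈ freeG n κ E :=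
  (mem_freeG_iff hκ hE).2 fun i j _ y hy _ => (hz j).trans_lt (hbd.2.2 i j y hy).2.1

lemma freeG_of_ge (hκ : KappaHyp n κ) (hE : IsPriorityGraph n κ E)
    (hbd : ObsBounds n κ xlo xhi) {z : Fin n → ℝ} (hz : xhi ≤ z) : z ∈ freeG n κ E :=
  (mem_freeG_iff hκ hE).2 fun i j _ y hy h =>
    absurd ((hz i).trans h) (not_le.2 (hbd.2.2 i j y hy).1.2)

lemma boxClamp_mem_freeG (hκ : KappaHyp n κ) (hE : IsPriorityGraph n κ E)
    (hbd : ObsBounds n κ xlo xhi) {lo hi z : Fin n → ℝ} (hlo : lo ≤ xlo) (hhi : xhi ≤ hi)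
    (hz : z ∈ freeG n κ E) : boxClamp lo hi z ∈ freeG n κ E := by
  rw [mem_freeG_iff hκ hE] at hz ⊢
  intro i j hij y hy h
  have hb := hbd.2.2 i j y hy
  have h1 := hlo j
  have h2 := hhi i
  have h3 := hz i j hij y hy
  simp only [boxClamp, Pi.sup_apply, Pi.inf_apply, sup_le_iff, inf_le_iff, sup_lt_iff,
    inf_lt_iff] at h ⊢
  refine ⟨h1.trans_lt hb.2.1, Or.inl (h3 ?_)⟩
  rcases h.2 with h | h
  · exact h
  · linarith [hb.1.2]

lemma boxClamp_mem_ero (hκ : KappaHyp n κ) (hE : IsPriorityGraph n κ E)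
    (hbd : ObsBounds n κ xlo xhi) {lo hi z : Fin n → ℝ} {r : ℝ}
    (hlo : ∀ i, lo i ≤ xlo i - r) (hhi : ∀ i, xhi i + r ≤ hi i)
    (hz : z ∈ ero n (freeG n κ E) r) : boxClamp lo hi z ∈ ero n (freeG n κ E) r := by
  intro d hd
  have heq : boxClamp lo hi z + d = boxClamp (lo + d) (hi + d) (z + d) := by
    ext i
    simp [boxClamp, max_add_add_right, min_add_add_right]
  rw [heq]
  refine boxClamp_mem_freeG hκ hE hbd (fun i => ?_) (fun i => ?_) (hz d hd)
  · have := abs_le.1 (hd i)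
    simp only [Pi.add_apply]
    linarith [hlo i]
  · have := abs_le.1 (hd i)
    simp only [Pi.add_apply]
    linarith [hhi i]

lemma boxClamp_mem_dil (hκ : KappaHyp n κ) (hE : IsPriorityGraph n κ E)
    (hbd : ObsBounds n κ xlo xhi) {lo hi z : Fin n → ℝ} {r : ℝ} (hlo : lo ≤ xlo)
    (hhi : xhi ≤ hi) (hz : z ∈ dil n (freeG n κ E) r) :
    boxClamp lo hi z ∈ dil n (freeG n κ E) r := by
  obtain ⟨y, hy, d, hd, rfl⟩ := hz
  refine ⟨boxClamp lo hi y, boxClamp_mem_freeG hκ hE hbd hlo hhi hy,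
    boxClamp lo hi (y + d) - boxClamp lo hi y, fun i => ?_, by simp⟩
  have h1 := abs_max_sub_max_le_abs (min (y i + d i) (hi i)) (min (y i) (hi i)) (lo i)
  have h2 := abs_min_sub_min_le_max (y i + d i) (hi i) (y i) (hi i)
  rw [add_sub_cancel_left, sub_self, abs_zero, max_eq_left (abs_nonneg _)] at h2
  refine le_trans ?_ (h2.trans (hd i))
  simpa [boxClamp, max_comm] using h1

end FreeSpace

section Extrema

variable {n : ℕ} {κ : Fin n → Fin n → Set (ℝ × ℝ)} {E : Fin n → Fin n → Prop}
  {xlo xhi : Fin n → ℝ}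

lemma sSup_mem_marginSetS (hκ : KappaHyp n κ) (hE : IsPriorityGraph n κ E)
    (hbd : ObsBounds n κ xlo xhi) (hφ : ∃ φ : ℝ → Fin n → ℝ, PhiMem n (freeG n κ E) φ)
    (hS : BddAbove (marginSetS n κ E)) :
    sSup (marginSetS n κ E) ∈ marginSetS n κ E := by
  have hzero : (0 : ℝ) ∈ marginSetS n κ E := by
    obtain ⟨φ, h1, h2, h3, h4, h5⟩ := hφ
    exact ⟨le_rfl, φ, h1, h2, fun t ht => subset_ero_zero (h3 t ht),
      fun d hd => subset_ero_zero (h4 d hd), fun d hd => subset_ero_zero (h5 d hd)⟩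
  set ρ := sSup (marginSetS n κ E)
  have hρ0 : 0 ≤ ρ := le_csSup hS hzero
  rcases hρ0.eq_or_lt with hρ | hρ
  · rwa [← hρ]
  have hcl : IsClosed (freeG n κ E) := isClosed_freeG hκ
  let lo : Fin n → ℝ := fun i => min (xlo i) (xhi i) - ρ
  let hi : Fin n → ℝ := fun i => max (xlo i) (xhi i) + ρ
  have hlohi : lo ≤ hi := fun i => by
    have := min_le_max (a := xlo i) (b := xhi i)
    simp only [lo, hi]
    linarith
  have hlo : ∀ i, lo i ≤ xlo i - ρ := fun i => sub_le_sub_right (min_le_left _ _) _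
  have hhi : ∀ i, xhi i + ρ ≤ hi i := fun i => by
    simp only [hi]
    linarith [le_max_right (xlo i) (xhi i)]
  have : Nonempty (marginSetS n κ E) := ⟨⟨0, hzero⟩⟩
  obtain ⟨γ, hγ⟩ := sumPaths_iInter_nonempty (lo := lo) (hi := hi)
    (fun r : marginSetS n κ E => ero n (freeG n κ E) r)
    (directed_of_isDirected_le fun r s hrs => ero_antitone _ hrs)
    (fun r => isClosed_ero hcl r) fun r => by
      obtain ⟨_, φ, h⟩ := r.2
      have hr : (r : ℝ) ≤ ρ := le_csSup hS r.2
      exact sumPaths_nonempty_of_phiMem hlohi (fun x hx => boxClamp_mem_ero hκ hE hbd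
        (fun i => by linarith [hlo i]) (fun i => by linarith [hhi i]) hx) h
  refine ⟨hρ0, γ, phiMem_of_mem_sumPaths ?_ ?_ (sumPaths_mono
    (iInter_ero_subset_ero_sSup hcl ⟨0, hzero⟩ (fun r hr => hr.1) hρ) hγ)⟩
  · intro d hd e he
    refine freeG_of_le hκ hE hbd fun i => ?_
    have h1 := abs_le.1 (he i)
    have h2 := hd i
    simp only [Pi.add_apply, Pi.sub_apply, Pi.zero_apply] at h2 ⊢
    linarith [hlo i]
  · intro d hd e he
    refine freeG_of_ge hκ hE hbd fun i => ?_
    have h1 := abs_le.1 (he i)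
    have h2 := hd i
    simp only [Pi.add_apply, Pi.zero_apply] at h2 ⊢
    linarith [hhi i]

lemma marginSetT_nonempty (hκ : KappaHyp n κ) (hE : IsPriorityGraph n κ E)
    (hbd : ObsBounds n κ xlo xhi) : (marginSetT n κ E).Nonempty := by
  let lo : Fin n → ℝ := xlo ⊓ xhi
  let hi : Fin n → ℝ := xlo ⊔ xhi
  have hlohi : lo ≤ hi := inf_le_sup
  have hr : 0 < ‖hi - lo‖ + 1 := by positivity
  have hlo : ∀ d : Fin n → ℝ, 0 ≤ d → lo - d ∈ freeG n κ E := fun d hd =>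
    freeG_of_le hκ hE hbd ((sub_le_self _ hd).trans inf_le_left)
  have hhi : ∀ d : Fin n → ℝ, 0 ≤ d → hi + d ∈ freeG n κ E := fun d hd =>
    freeG_of_ge hκ hE hbd (le_sup_right.trans (le_add_of_nonneg_right hd))
  refine ⟨‖hi - lo‖ + 1, hr, fun t => lo + t • (hi - lo), by fun_prop, ?_, ?_, ?_, ?_⟩
  · intro s _ t _ hst
    exact add_le_add_right (smul_le_smul_of_nonneg_right hst (sub_nonneg.2 hlohi)) _
  · intro t ht
    refine ⟨lo, by simpa using hlo 0 le_rfl, t • (hi - lo), fun i => ?_, rfl⟩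
    have h1 : |(hi - lo) i| ≤ ‖hi - lo‖ := norm_le_pi_norm (hi - lo) i
    rw [Pi.smul_apply, smul_eq_mul, abs_mul, abs_of_nonneg ht.1]
    nlinarith [ht.1, ht.2, abs_nonneg ((hi - lo) i)]
  · intro d hd
    simpa using subset_dil hr.le (hlo d hd)
  · intro d hd
    simpa using subset_dil hr.le (hhi d hd)

lemma sInf_mem_marginSetT (hκ : KappaHyp n κ) (hE : IsPriorityGraph n κ E)
    (hbd : ObsBounds n κ xlo xhi)
    (hφ : ¬ ∃ φ : ℝ → Fin n → ℝ, PhiMem n (freeG n κ E) φ) :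
    sInf (marginSetT n κ E) ∈ marginSetT n κ E := by
  have hne := marginSetT_nonempty hκ hE hbd
  have hρ0 : 0 ≤ sInf (marginSetT n κ E) := le_csInf hne fun r hr => hr.1.le
  have hcl : IsClosed (freeG n κ E) := isClosed_freeG hκ
  let lo : Fin n → ℝ := xlo ⊓ xhi
  let hi : Fin n → ℝ := xlo ⊔ xhi
  have hlohi : lo ≤ hi := inf_le_sup
  have := hne.to_subtype
  obtain ⟨γ, hγ⟩ := sumPaths_iInter_nonempty (lo := lo) (hi := hi)
    (fun r : marginSetT n κ E => dil n (freeG n κ E) r)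
    (directed_of_isDirected_ge fun r s hrs => dil_monotone _ hrs)
    (fun r => by
      rw [dil_eq_cthickening hcl r.2.1.le]
      exact Metric.isClosed_cthickening) fun r => by
      obtain ⟨_, φ, h⟩ := r.2
      exact sumPaths_nonempty_of_phiMem hlohi (fun x hx => boxClamp_mem_dil hκ hE hbd
        inf_le_left le_sup_right hx) h
  have hmem : PhiMem n (dil n (freeG n κ E) (sInf (marginSetT n κ E))) γ :=
    phiMem_of_mem_sumPaths
      (fun d hd => subset_dil hρ0 <|
        freeG_of_le hκ hE hbd ((sub_le_self _ hd).trans inf_le_left))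
      (fun d hd => subset_dil hρ0 <|
        freeG_of_ge hκ hE hbd (le_sup_right.trans (le_add_of_nonneg_right hd)))
      (sumPaths_mono (iInter_dil_subset_dil_sInf hcl hne fun r hr => hr.1.le) hγ)
  refine ⟨hρ0.lt_of_ne fun h0 => hφ ⟨γ, ?_⟩, γ, hmem⟩
  rwa [← h0, dil_eq_cthickening hcl le_rfl, Metric.cthickening_zero, hcl.closure_eq] at hmem

end Extrema

/-- existence of paths with maximal margin: (1) if `Φ(χ^free_G) ≠ ∅`
and `S` is bounded above then `sSup S ∈ S`; (2) if `Φ(χ^free_G) = ∅` then `T` is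
nonempty and `sInf T ∈ T`. -/
theorem stmt14 (n : ℕ) (hn : 1 ≤ n) (κ : Fin n → Fin n → Set (ℝ × ℝ))
    (hκ : KappaHyp n κ) (xlo xhi : Fin n → ℝ) (hbd : ObsBounds n κ xlo xhi)
    (E : Fin n → Fin n → Prop) (hE : IsPriorityGraph n κ E) :
    ((∃ φ : ℝ → Fin n → ℝ, PhiMem n (freeG n κ E) φ) →
      BddAbove (marginSetS n κ E) →
      sSup (marginSetS n κ E) ∈ marginSetS n κ E) ∧
    ((¬ ∃ φ : ℝ → Fin n → ℝ, PhiMem n (freeG n κ E) φ) →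
      (marginSetT n κ E).Nonempty ∧ sInf (marginSetT n κ E) ∈ marginSetT n κ E) := by
  exact ⟨sSup_mem_marginSetS hκ hE hbd, fun h =>
    ⟨marginSetT_nonempty hκ hE hbd, sInf_mem_marginSetT hκ hE hbd h⟩⟩
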